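/- Let φ : Σ^{ℓ+1} → Finset(Σ) be a non-deterministic local transition rule with φ(w) nonempty for every w, and call φ number-conserving if for every configuration a : ℤ → Σ with finite particle content and every configuration b with b_x ∈ φ(a_{x−ℓ}, …, a_x) for all x ∈ ℤ and b of finite particle content, one has #b = #a, and moreover every such b has finite particle content. If φ is number-conserving, then for every w ∈ Σ^{ℓ+1} and all α, β ∈ φ(w), #α = #β. -/

import Mathlib

/-- The state set `Σ = {0, 1, …, C}`. -/
abbrev St (C : ℕ) := Fin (C + 1)

/-- Particle content `#w` of a string `w ∈ Σ^n`. -/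
def content {C n : ℕ} (w : Fin n → St C) : ℤ := ∑ i, (w i : ℤ)

/-- The prefix `w_{0:k}` of a string `w ∈ Σ^{k+1}`. -/
def prefixStr {C k : ℕ} (w : Fin (k + 1) → St C) : Fin k → St C :=
  fun i => w i.castSucc

/-- The suffix `w_{1:k}` of a string `w ∈ Σ^{k+1}`. -/
def suffixStr {C k : ℕ} (w : Fin (k + 1) → St C) : Fin k → St C :=
  fun i => w i.succ

/-- `f : Σ^ℓ → ℤ` is a flow function of width `ℓ`:
`0 ≤ f(w_{0:ℓ}) + #w_ℓ − f(w_{1:ℓ}) ≤ C` for all `w ∈ Σ^{ℓ+1}`. -/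
def IsFlow (C ℓ : ℕ) (f : (Fin ℓ → St C) → ℤ) : Prop :=
  ∀ w : Fin (ℓ + 1) → St C,
    0 ≤ f (prefixStr w) + (w (Fin.last ℓ) : ℤ) - f (suffixStr w) ∧
      f (prefixStr w) + (w (Fin.last ℓ) : ℤ) - f (suffixStr w) ≤ (C : ℤ)

/-- A configuration `a : ℤ → Σ` has finite particle content if only finitely
many cells are in a state with non-zero content. -/
def FiniteContent {C : ℕ} (a : ℤ → St C) : Prop := {x : ℤ | a x ≠ 0}.Finite

/-- The total particle content `#a` of a configuration. -/
noncomputable def totContent {C : ℕ} (a : ℤ → St C) : ℤ := ∑ᶠ x : ℤ, (a x : ℤ)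

/-- The neighbourhood `(a_{x−ℓ}, …, a_x)` of the boundary at `x`. -/
def nbhd {C : ℕ} (ℓ : ℕ) (a : ℤ → St C) (x : ℤ) : Fin (ℓ + 1) → St C :=
  fun i => a (x - (ℓ : ℤ) + (i : ℕ))

/-- In a non-deterministic number-conserving cellular automaton, all possible
next states for a given neighbourhood have the same particle content. -/
theorem nondet_number_conserving_constant_content (C ℓ : ℕ) (hC : 1 ≤ C) (hℓ : 1 ≤ ℓ)
    (φ : (Fin (ℓ + 1) → St C) → Finset (St C))
    (hne : ∀ w : Fin (ℓ + 1) → St C, (φ w).Nonempty)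
    (hcons : ∀ a : ℤ → St C, FiniteContent a →
      ∀ b : ℤ → St C, (∀ x : ℤ, b x ∈ φ (nbhd ℓ a x)) →
        FiniteContent b ∧ totContent b = totContent a) :
    ∀ w : Fin (ℓ + 1) → St C, ∀ α ∈ φ w, ∀ β ∈ φ w, (α : ℤ) = (β : ℤ) := by
  intro w α hα β hβ
  let a : ℤ → St C := fun x => if h : 0 ≤ x ∧ x ≤ (ℓ : ℤ) then w ⟨x.toNat, by omega⟩ else 0
  have ha : FiniteContent a := by
    refine (Set.finite_Icc (0 : ℤ) (ℓ : ℤ)).subset ?_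
    intro x hx
    by_contra hn
    exact hx (dif_neg hn)
  have hw : nbhd ℓ a (ℓ : ℤ) = w := by
    funext i
    have hi := i.isLt
    have h : 0 ≤ (ℓ : ℤ) - (ℓ : ℤ) + (i : ℕ) ∧ (ℓ : ℤ) - (ℓ : ℤ) + (i : ℕ) ≤ (ℓ : ℤ) := by omega
    show a ((ℓ : ℤ) - (ℓ : ℤ) + (i : ℕ)) = w i
    simp only [a]
    rw [dif_pos h]
    congr 1
    apply Fin.ext
    simp
  choose c hc using hne
  have key : ∀ γ ∈ φ w, ∀ x : ℤ,
      Function.update (fun x => c (nbhd ℓ a x)) (ℓ : ℤ) γ x ∈ φ (nbhd ℓ a x) := by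
    intro γ hγ x
    by_cases hx : x = (ℓ : ℤ)
    · subst hx
      rw [Function.update_self, hw]
      exact hγ
    · rw [Function.update_of_ne hx]
      exact hc _
  obtain ⟨f1, t1⟩ := hcons a ha _ (key α hα)
  obtain ⟨f2, t2⟩ := hcons a ha _ (key β hβ)
  have supp : ∀ b : ℤ → St C, FiniteContent b →
      (Function.support fun x => ((b x : ℕ) : ℤ)).Finite := by
    intro b hb
    refine hb.subset ?_
    intro x hx h0
    apply hx
    simp [h0]
  have e := t1.trans t2.symm
  unfold totContent at e
  rw [← sub_eq_zero, ← finsum_sub_distrib (supp _ f1) (supp _ f2),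
    finsum_eq_single _ (ℓ : ℤ)] at e
  · simp only [Function.update_self] at e
    exact sub_eq_zero.mp e
  · intro x hx
    simp only [Function.update_of_ne hx, sub_self]
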